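/- arXiv:1803.00948 — 2 statements merged into one kernel-verified Lean document; each statement's English description precedes it below -/
import Mathlib

section
/- Let X be a real Hilbert space, a : X × X → ℝ a symmetric, bounded bilinear form that is coercive with constant α > 0, and let α̂ satisfy 0 < α̂ ≤ α. Let f : X → ℝ be a bounded linear functional, W ⊆ X a closed subspace, u ∈ X the solution of a(u, v) = f(v) for all v ∈ X, and u_k ∈ W the Galerkin solution satisfying a(u_k, v) = f(v) for all v ∈ W. Define s = f(u), s_k = f(u_k), the residual r(v) = f(v) − a(u_k, v), and ε_k = sup_{v ∈ X, v ≠ 0} r(v)/‖v‖. Then |s − s_k| ≤ ε_k² / α̂. -/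
/-- Compliant a posteriori output error bound: for the Galerkin solution `u_k ∈ W` of a
symmetric, bounded, coercive problem, the output error `|s - s_k| = |f(u) - f(u_k)|` is
bounded by the square of the dual norm of the residual divided by the lower coercivity
bound `α̂`. -/
theorem compliant_output_error_bound {X : Type*} [NormedAddCommGroup X]
    [InnerProductSpace ℝ X] [CompleteSpace X]
    (a : X →ₗ[ℝ] X →ₗ[ℝ] ℝ)
    (hsym : ∀ w v : X, a w v = a v w)
    (γ : ℝ) (hγ : 0 < γ) (hbound : ∀ w v : X, |a w v| ≤ γ * ‖w‖ * ‖v‖)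
    (α : ℝ) (hα : 0 < α) (hcoer : ∀ w : X, α * ‖w‖ ^ 2 ≤ a w w)
    (αhat : ℝ) (hαhat : 0 < αhat) (hαhatle : αhat ≤ α)
    (f : X →L[ℝ] ℝ)
    (W : Submodule ℝ X) (hW : IsClosed (W : Set X))
    (u : X) (hu : ∀ v : X, a u v = f v)
    (uk : X) (huk : uk ∈ W) (huksol : ∀ v ∈ W, a uk v = f v) :
    |f u - f uk| ≤
      (⨆ v : {v : X // v ≠ 0}, (f (v : X) - a uk (v : X)) / ‖(v : X)‖) ^ 2 / αhat := by
  have hres : ∀ v : X, f v - a uk v = a (u - uk) v := fun v => by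
    rw [map_sub, LinearMap.sub_apply, hu]
  have henergy : f u - f uk = a (u - uk) (u - uk) := by
    rw [← hres, map_sub, map_sub, hsym uk u, hu, huksol uk huk]
    ring
  rw [henergy]
  set e := u - uk
  simp only [hres]
  set ε := ⨆ v : {v : X // v ≠ 0}, a e (v : X) / ‖(v : X)‖
  have henergy_nonneg : 0 ≤ a e e := (by positivity : 0 ≤ α * ‖e‖ ^ 2).trans (hcoer e)
  rw [abs_of_nonneg henergy_nonneg, le_div_iff₀ hαhat]
  rcases eq_or_ne e 0 with he | he
  · rw [he, map_zero, zero_mul]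
    positivity
  have hnorm : 0 < ‖e‖ := norm_pos_iff.mpr he
  have hbdd : BddAbove (Set.range fun v : {v : X // v ≠ 0} => a e (v : X) / ‖(v : X)‖) := by
    refine ⟨γ * ‖e‖, ?_⟩
    rintro _ ⟨v, rfl⟩
    exact (div_le_iff₀ (norm_pos_iff.mpr v.2)).mpr ((le_abs_self _).trans (hbound e v))
  have hdual : a e e ≤ ε * ‖e‖ := (div_le_iff₀ hnorm).mp (le_ciSup hbdd ⟨e, he⟩)
  have hcoer_hat : αhat * ‖e‖ ^ 2 ≤ a e e := le_trans (by gcongr) (hcoer e)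
  have henergy_pos : 0 < a e e := lt_of_lt_of_le (by positivity) hcoer_hat
  refine le_of_mul_le_mul_right ?_ henergy_pos
  calc a e e * αhat * a e e = αhat * (a e e) ^ 2 := by ring
    _ ≤ αhat * (ε * ‖e‖) ^ 2 := by gcongr
    _ = ε ^ 2 * (αhat * ‖e‖ ^ 2) := by ring
    _ ≤ ε ^ 2 * a e e := by gcongr
end

section
/- Let X be a real Hilbert space, a₀ : X × X → ℝ a symmetric, bounded, coercive bilinear form, a₁ : X × X → ℝ a symmetric, bounded, positive-semidefinite bilinear form (a₁(w,w) ≥ 0 for all w), f : X → ℝ a bounded linear functional, and μ_max > 0. For each μ ∈ [0, μ_max] let u(μ) ∈ X be the unique solution of a₀(u(μ), v) + μ a₁(u(μ), v) = f(v) for all v ∈ X (which exists by the Lax–Milgram theorem, since a₀ + μ a₁ is bounded and coercive for μ ≥ 0). Let σ̄ > 0 be an upper bound for sup_{w ≠ 0} a₁(w,w)/a₀(w,w). Then there exist an integer N_crit and constants C > 0, c > 0 such that for every N ≥ N_crit the following holds: with the logarithmically distributed sample points μ₁, …, μ_N ∈ [0, μ_max] defined by ln(σ̄ μ_n + 1)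 = ((n−1)/(N−1)) ln(σ̄ μ_max + 1) for n = 1, …, N, and with W_N = span{u(μ₁), …, u(μ_N)}, the Galerkin approximation u_N(μ) ∈ W_N (characterized by a₀(u_N(μ), v) + μ a₁(u_N(μ), v) = f(v) for all v ∈ W_N) satisfies ‖u(μ) − u_N(μ)‖ ≤ C e^{−cN} for every μ ∈ [0, μ_max]. -/
open scoped BigOperators

/-- Lax–Milgram for all right-hand sides `b v` at once: a bounded form `b` is represented by a
linear operator with respect to a bounded coercive form `a`. -/
theorem exists_linearMap_bilin_eq
    {X : Type*} [NormedAddCommGroup X] [InnerProductSpace ℝ X] [CompleteSpace X]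
    (a b : X →ₗ[ℝ] X →ₗ[ℝ] ℝ)
    {γ : ℝ} (ha : ∀ w v : X, |a w v| ≤ γ * ‖w‖ * ‖v‖)
    {β : ℝ} (hb : ∀ w v : X, |b w v| ≤ β * ‖w‖ * ‖v‖)
    {α : ℝ} (hα : 0 < α) (hcoer : ∀ w : X, α * ‖w‖ ^ 2 ≤ a w w) :
    ∃ B : X →ₗ[ℝ] X, ∀ v w : X, a (B v) w = b v w := by
  let A : X →L[ℝ] X →L[ℝ] ℝ := LinearMap.mkContinuous₂ a γ ha
  let S : X →L[ℝ] X →L[ℝ] ℝ := LinearMap.mkContinuous₂ b β hb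
  have hA : IsCoercive A := ⟨α, hα, fun w => by
    have := hcoer w
    simp only [A, LinearMap.mkContinuous₂_apply]
    nlinarith⟩
  refine ⟨(hA.continuousLinearEquivOfBilin.symm : X →L[ℝ] X).toLinearMap ∘ₗ
    (InnerProductSpace.continuousLinearMapOfBilin S).toLinearMap, fun v w => ?_⟩
  have h := hA.continuousLinearEquivOfBilin_apply
    (hA.continuousLinearEquivOfBilin.symm
      (InnerProductSpace.continuousLinearMapOfBilin S v)) w
  rw [ContinuousLinearEquiv.apply_symm_apply,
    InnerProductSpace.continuousLinearMapOfBilin_apply] at h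
  exact h.symm

theorem norm_le_of_coercive_of_le
    {X : Type*} [NormedAddCommGroup X] [InnerProductSpace ℝ X]
    (a : X →ₗ[ℝ] X →ₗ[ℝ] ℝ) {α : ℝ} (hα : 0 < α) (hcoer : ∀ w : X, α * ‖w‖ ^ 2 ≤ a w w)
    {z : X} {K : ℝ} (hK : 0 ≤ K) (h : a z z ≤ K * ‖z‖) : ‖z‖ ≤ K / α := by
  rw [le_div_iff₀ hα]
  rcases (norm_nonneg z).eq_or_lt with h0 | h0
  · rw [← h0]; simpa using hK
  · have := hcoer z
    nlinarith

/-- Interpolation at `k` distinct nodes: the remainder contracts by a factor `q` per node. -/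
theorem exists_small_remainder {X : Type*} [NormedAddCommGroup X] [NormedSpace ℝ X]
    (u : ℝ → X) (ν : ℕ → ℝ) (μ q : ℝ) (k : ℕ)
    (B : ℕ → X →ₗ[ℝ] X)
    (hB : ∀ j < k, (ν j - μ) • B j (u μ) = u μ - u (ν j))
    (hB' : ∀ j < k, ∀ i < j, (ν j - ν i) • B j (u (ν i)) = u (ν i) - u (ν j))
    (hq : ∀ j < k, ∀ v, ‖(ν j - μ) • B j v‖ ≤ q * ‖v‖) (hq0 : 0 ≤ q)
    (hν : ∀ j < k, ∀ i < j, ν i ≠ ν j) :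
    ∃ e : X, ‖e‖ ≤ q ^ k * ‖u μ‖ ∧
      u μ - e ∈ Submodule.span ℝ ((fun i => u (ν i)) '' Set.Iio k) := by
  induction k with
  | zero => exact ⟨u μ, by simp⟩
  | succ k ih =>
    obtain ⟨e, he, hmem⟩ := ih (fun j hj => hB j (by omega)) (fun j hj => hB' j (by omega))
      (fun j hj => hq j (by omega)) (fun j hj => hν j (by omega))
    have hlt : k < k + 1 := k.lt_succ_self
    have hk : u (ν k) ∈ Submodule.span ℝ ((fun i => u (ν i)) '' Set.Iio (k + 1)) :=
      Submodule.subset_span ⟨k, hlt, rfl⟩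
    refine ⟨(ν k - μ) • B k e, ?_, ?_⟩
    · calc ‖(ν k - μ) • B k e‖ ≤ q * ‖e‖ := hq k hlt e
        _ ≤ q * (q ^ k * ‖u μ‖) := by gcongr
        _ = q ^ (k + 1) * ‖u μ‖ := by ring
    · have hle : Submodule.span ℝ ((fun i => u (ν i)) '' Set.Iio k) ≤
          (Submodule.span ℝ ((fun i => u (ν i)) '' Set.Iio (k + 1))).comap (B k) := by
        rw [Submodule.span_le]
        rintro _ ⟨i, hi, rfl⟩
        have hi : i < k := hi
        have hne : ν k - ν i ≠ 0 := sub_ne_zero.2 (hν k hlt i hi).symm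
        have : B k (u (ν i)) = (ν k - ν i)⁻¹ • (u (ν i) - u (ν k)) := by
          rw [← hB' k hlt i hi, inv_smul_smul₀ hne]
        change B k (u (ν i)) ∈ Submodule.span ℝ ((fun i => u (ν i)) '' Set.Iio (k + 1))
        rw [this]
        exact Submodule.smul_mem _ _
          (sub_mem (Submodule.subset_span ⟨i, Nat.lt_succ_of_lt hi, rfl⟩) hk)
      have key : u μ - (ν k - μ) • B k e = u (ν k) + (ν k - μ) • B k (u μ - e) := by
        rw [map_sub, smul_sub, hB k hlt]
        abel
      rw [key]
      exact add_mem hk (Submodule.smul_mem _ _ (hle hmem))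

theorem abs_exp_sub_exp_le {s t L : ℝ} (hs : s ≤ L) (ht : t ≤ L) :
    |Real.exp s - Real.exp t| ≤ Real.exp L * |s - t| := by
  wlog h : t ≤ s generalizing s t
  · rw [abs_sub_comm, abs_sub_comm s]
    exact this ht hs (le_of_not_ge h)
  rw [abs_of_nonneg (sub_nonneg.2 (Real.exp_le_exp.2 h)), abs_of_nonneg (sub_nonneg.2 h)]
  have h1 := Real.add_one_le_exp (t - s)
  have h2 : Real.exp t = Real.exp s * Real.exp (t - s) := by rw [← Real.exp_add]; ring_nf
  have h3 := Real.exp_le_exp.2 hs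
  nlinarith [Real.exp_pos s]

/-- Any point of `[0, m]` has a block of `k` consecutive integers of `[0, m]` within distance `k`. -/
theorem exists_block_near {m k : ℕ} (hk : k ≤ m) {x : ℝ} (hx0 : 0 ≤ x) (hxm : x ≤ m) :
    ∃ b : ℕ, ∀ i < k, b + i ≤ m ∧ |((b + i : ℕ) : ℝ) - x| ≤ k := by
  have h1 := Nat.floor_le hx0
  have h2 := Nat.lt_floor_add_one x
  have h3 : ⌊x⌋₊ ≤ m := Nat.floor_le_of_le hxm
  refine ⟨⌊x⌋₊ + 1 - k, fun i hi => ⟨by omega, ?_⟩⟩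
  have h4 : ((⌊x⌋₊ + 1 - k + i : ℕ) : ℝ) ≤ x + k := by
    rcases le_total k (⌊x⌋₊ + 1) with h | h
    · have : ⌊x⌋₊ + 1 - k + i ≤ ⌊x⌋₊ + k := by omega
      have : ((⌊x⌋₊ + 1 - k + i : ℕ) : ℝ) ≤ ⌊x⌋₊ + k := by exact_mod_cast this
      linarith
    · have : ⌊x⌋₊ + 1 - k + i ≤ k := by omega
      have : ((⌊x⌋₊ + 1 - k + i : ℕ) : ℝ) ≤ k := by exact_mod_cast this
      linarith
  have h5 : (⌊x⌋₊ : ℝ) + 1 ≤ ((⌊x⌋₊ + 1 - k + i : ℕ) : ℝ) + k := by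
    have : ⌊x⌋₊ + 1 ≤ ⌊x⌋₊ + 1 - k + i + k := by omega
    exact_mod_cast this
  rw [abs_le]
  constructor <;> linarith

/-- Exponential convergence of the reduced basis method for a one-parameter affine family
`a(·,·;μ) = a₀ + μ a₁` on `D = [0, μ_max]`: there are `N_crit`, `C > 0`, `c > 0` such that for
every `N ≥ N_crit`, with the logarithmically distributed sample points
`ln(σ̄ μ_n + 1) = ((n-1)/(N-1)) ln(σ̄ μ_max + 1)` and the reduced basis space
`W_N = span {u(μ₁), …, u(μ_N)}`, the Galerkin approximation `u_N(μ) ∈ W_N` satisfies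
`‖u(μ) - u_N(μ)‖ ≤ C e^{-cN}` uniformly in `μ ∈ [0, μ_max]`. -/
theorem reduced_basis_exponential_convergence
    {X : Type*} [NormedAddCommGroup X] [InnerProductSpace ℝ X] [CompleteSpace X]
    (a₀ a₁ : X →ₗ[ℝ] X →ₗ[ℝ] ℝ)
    (hsym₀ : ∀ w v : X, a₀ w v = a₀ v w) (hsym₁ : ∀ w v : X, a₁ w v = a₁ v w)
    (γ₀ : ℝ) (hγ₀ : 0 < γ₀) (hbound₀ : ∀ w v : X, |a₀ w v| ≤ γ₀ * ‖w‖ * ‖v‖)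
    (γ₁ : ℝ) (hγ₁ : 0 < γ₁) (hbound₁ : ∀ w v : X, |a₁ w v| ≤ γ₁ * ‖w‖ * ‖v‖)
    (α : ℝ) (hα : 0 < α) (hcoer : ∀ w : X, α * ‖w‖ ^ 2 ≤ a₀ w w)
    (hpsd : ∀ w : X, 0 ≤ a₁ w w)
    (f : X →L[ℝ] ℝ)
    (μmax : ℝ) (hμmax : 0 < μmax)
    (u : ℝ → X)
    (hu : ∀ μ ∈ Set.Icc (0 : ℝ) μmax, ∀ v : X, a₀ (u μ) v + μ * a₁ (u μ) v = f v)
    (σ : ℝ) (hσ : 0 < σ)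
    (hσub : ∀ w : X, w ≠ 0 → a₁ w w / a₀ w w ≤ σ) :
    ∃ Ncrit : ℕ, ∃ C > (0 : ℝ), ∃ c > (0 : ℝ), ∀ N : ℕ, Ncrit ≤ N →
      ∀ μs : Fin N → ℝ,
        (∀ n : Fin N, μs n ∈ Set.Icc (0 : ℝ) μmax ∧
          Real.log (σ * μs n + 1) = ((n : ℝ) / ((N : ℝ) - 1)) * Real.log (σ * μmax + 1)) →
        ∀ uN : ℝ → X,
          (∀ μ ∈ Set.Icc (0 : ℝ) μmax,
            uN μ ∈ Submodule.span ℝ (Set.range fun n : Fin N => u (μs n)) ∧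
            ∀ v ∈ Submodule.span ℝ (Set.range fun n : Fin N => u (μs n)),
              a₀ (uN μ) v + μ * a₁ (uN μ) v = f v) →
          ∀ μ ∈ Set.Icc (0 : ℝ) μmax,
            ‖u μ - uN μ‖ ≤ C * Real.exp (-c * N) := by
  have hcoerμ : ∀ μ : ℝ, 0 ≤ μ → ∀ w : X, α * ‖w‖ ^ 2 ≤ (a₀ + μ • a₁) w w := fun μ hμ w => by
    have := mul_nonneg hμ (hpsd w)
    have := hcoer w
    simp only [LinearMap.add_apply, LinearMap.smul_apply, smul_eq_mul]
    linarith
  have hboundμ : ∀ μ : ℝ, 0 ≤ μ → ∀ w v : X,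
      |(a₀ + μ • a₁) w v| ≤ (γ₀ + μ * γ₁) * ‖w‖ * ‖v‖ := fun μ hμ w v => by
    simp only [LinearMap.add_apply, LinearMap.smul_apply, smul_eq_mul]
    calc |a₀ w v + μ * a₁ w v| ≤ |a₀ w v| + μ * |a₁ w v| := by
          rw [← abs_of_nonneg hμ, ← abs_mul, abs_of_nonneg hμ]; exact abs_add_le _ _
      _ ≤ γ₀ * ‖w‖ * ‖v‖ + μ * (γ₁ * ‖w‖ * ‖v‖) := by
          gcongr
          · exact hbound₀ w v
          · exact hbound₁ w v
      _ = _ := by ring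
  have huniq : ∀ μ : ℝ, 0 ≤ μ → ∀ z : X, (∀ v, (a₀ + μ • a₁) z v = 0) → z = 0 :=
    fun μ hμ z hz => by
      have := norm_le_of_coercive_of_le (a₀ + μ • a₁) hα (hcoerμ μ hμ) le_rfl
        (z := z) (by rw [hz z, zero_mul])
      simpa using this
  have hu' : ∀ μ ∈ Set.Icc (0 : ℝ) μmax, ‖u μ‖ ≤ ‖f‖ / α := fun μ hμ => by
    refine norm_le_of_coercive_of_le _ hα (hcoerμ μ hμ.1) (norm_nonneg f) ?_
    have := hu μ hμ (u μ)
    simp only [LinearMap.add_apply, LinearMap.smul_apply, smul_eq_mul]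
    rw [this]
    exact (le_abs_self _).trans (f.le_opNorm _)
  have hBex : ∀ ν : ℝ, ∃ B : X →ₗ[ℝ] X, 0 ≤ ν → ∀ v w : X,
      (a₀ + ν • a₁) (B v) w = a₁ v w := fun ν => by
    by_cases hν : 0 ≤ ν
    · obtain ⟨B, hB⟩ := exists_linearMap_bilin_eq (a₀ + ν • a₁) a₁ (hboundμ ν hν) hbound₁ hα
        (hcoerμ ν hν)
      exact ⟨B, fun _ => hB⟩
    · exact ⟨0, fun h => absurd h hν⟩
  choose B hB using hBex
  have hBnorm : ∀ ν : ℝ, 0 ≤ ν → ∀ v, ‖B ν v‖ ≤ γ₁ * ‖v‖ / α := fun ν hν v => by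
    refine norm_le_of_coercive_of_le _ hα (hcoerμ ν hν) (by positivity) ?_
    rw [hB ν hν]
    exact (le_abs_self _).trans (hbound₁ _ _)
  have hBu : ∀ ν ∈ Set.Icc (0 : ℝ) μmax, ∀ μ ∈ Set.Icc (0 : ℝ) μmax,
      (ν - μ) • B ν (u μ) = u μ - u ν := fun ν hν μ hμ => by
    rw [← sub_eq_zero]
    refine huniq ν hν.1 _ fun v => ?_
    have h1 := hu ν hν v
    have h2 := hu μ hμ v
    have h3 := hB ν hν.1 (u μ) v
    simp only [LinearMap.add_apply, LinearMap.smul_apply, smul_eq_mul, map_sub, map_smul,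
      LinearMap.sub_apply] at h3 ⊢
    linear_combination (ν - μ) * h3 + h1 - h2
  set L : ℝ := Real.log (σ * μmax + 1) with hL
  have hLpos : 0 < L := Real.log_pos (by nlinarith [mul_pos hσ hμmax])
  have hexpL : Real.exp L = σ * μmax + 1 := Real.exp_log (by positivity)
  set h : ℝ := min 1 (α * σ / (2 * γ₁ * Real.exp L * L)) with hh
  have hh0 : 0 < h := by positivity
  have hh1 : h ≤ 1 := min_le_left _ _
  have hh2 : h * L * Real.exp L / σ * γ₁ / α ≤ 1 / 2 := by
    have h2 : h ≤ α * σ / (2 * γ₁ * Real.exp L * L) := min_le_right _ _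
    calc h * L * Real.exp L / σ * γ₁ / α
        ≤ α * σ / (2 * γ₁ * Real.exp L * L) * L * Real.exp L / σ * γ₁ / α := by gcongr
      _ = 1 / 2 := by field_simp
  have hlog2 : 0 < Real.log 2 := Real.log_pos (by norm_num)
  refine ⟨2, (γ₀ + μmax * γ₁) * (‖f‖ / α + 1) / α * Real.exp ((h + 1) * Real.log 2),
    by positivity, h * Real.log 2, by positivity, ?_⟩
  intro N hN μs hμs uN huN μ hμ
  obtain ⟨m, rfl⟩ : ∃ m, N = m + 1 := ⟨N - 1, by omega⟩
  have hm : (0 : ℝ) < m := by exact_mod_cast (show 0 < m by omega)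
  set W := Submodule.span ℝ (Set.range fun n : Fin (m + 1) => u (μs n)) with hW
  set k := ⌊h * m⌋₊ with hk
  have hkh : (k : ℝ) ≤ h * m := Nat.floor_le (by positivity)
  have hkh' : h * m < k + 1 := Nat.lt_floor_add_one _
  have hkm : k ≤ m := by
    have : (k : ℝ) ≤ m := hkh.trans (by nlinarith)
    exact_mod_cast this
  have hμpos : 0 < σ * μ + 1 := by nlinarith [mul_nonneg hσ.le hμ.1]
  set t := Real.log (σ * μ + 1) with ht
  have ht0 : 0 ≤ t := Real.log_nonneg (by nlinarith [mul_nonneg hσ.le hμ.1])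
  have htL : t ≤ L := Real.log_le_log hμpos (by nlinarith [hμ.2])
  have hexpt : Real.exp t = σ * μ + 1 := Real.exp_log hμpos
  obtain ⟨b, hb⟩ := exists_block_near hkm (x := t / L * m) (by positivity)
    (by
      have : t / L ≤ 1 := (div_le_one hLpos).2 htL
      nlinarith)
  set s : ℕ → ℝ := fun n => (n : ℝ) / m * L with hs
  set ν : ℕ → ℝ := fun i => (Real.exp (s (b + i)) - 1) / σ with hν
  have hνμs : ∀ i (hi : b + i < m + 1), μs ⟨b + i, hi⟩ = ν i := fun i hi => by
    obtain ⟨h1, h2⟩ := hμs ⟨b + i, hi⟩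
    have h3 : 0 < σ * μs ⟨b + i, hi⟩ + 1 := by nlinarith [mul_nonneg hσ.le h1.1]
    have h4 : Real.log (σ * μs ⟨b + i, hi⟩ + 1) = s (b + i) := by
      rw [h2]; simp [hs]
    have h5 := Real.exp_log h3
    rw [h4] at h5
    simp only [hν]
    rw [h5]; field_simp; ring
  have hνmem : ∀ i < k, ν i ∈ Set.Icc (0 : ℝ) μmax := fun i hi => by
    rw [← hνμs i (by have := (hb i hi).1; omega)]
    exact (hμs _).1
  have hνinj : ∀ j < k, ∀ i < j, ν i ≠ ν j := fun j _ i hij => by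
    refine ne_of_lt ?_
    simp only [hν, hs]
    have : (i : ℝ) < j := by exact_mod_cast hij
    push_cast
    gcongr
  have hνclose : ∀ i < k, |ν i - μ| ≤ h * L * Real.exp L / σ := fun i hi => by
    obtain ⟨h1, h2⟩ := hb i hi
    have e1 : ν i - μ = (Real.exp (s (b + i)) - Real.exp t) / σ := by
      rw [hexpt]; simp only [hν]; field_simp; ring
    have e2 : s (b + i) - t = (((b + i : ℕ) : ℝ) - t / L * m) * (L / m) := by
      simp only [hs]; field_simp
    have e3 : |s (b + i) - t| ≤ h * L := by
      rw [e2, abs_mul, abs_of_pos (div_pos hLpos hm)]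
      calc _ ≤ (h * m) * (L / m) := by gcongr; exact h2.trans hkh
        _ = h * L := by field_simp
    have e4 : s (b + i) ≤ L := by
      have : ((b + i : ℕ) : ℝ) ≤ m := by exact_mod_cast h1
      have : ((b + i : ℕ) : ℝ) / m ≤ 1 := (div_le_one hm).2 this
      simp only [hs]
      nlinarith
    rw [e1, abs_div, abs_of_pos hσ]
    gcongr
    calc _ ≤ Real.exp L * |s (b + i) - t| := abs_exp_sub_exp_le e4 htL
      _ ≤ Real.exp L * (h * L) := by gcongr
      _ = _ := by ring
  obtain ⟨e, he, hmem⟩ := exists_small_remainder u ν μ (1 / 2) k (fun j => B (ν j))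
    (fun j hj => hBu _ (hνmem j hj) _ hμ)
    (fun j hj i hi => hBu _ (hνmem j hj) _ (hνmem i (hi.trans hj)))
    (fun j hj v => by
      rw [norm_smul, Real.norm_eq_abs]
      calc |ν j - μ| * ‖B (ν j) v‖ ≤ (h * L * Real.exp L / σ) * (γ₁ * ‖v‖ / α) := by
            gcongr
            · exact hνclose j hj
            · exact hBnorm _ (hνmem j hj).1 v
        _ = (h * L * Real.exp L / σ * γ₁ / α) * ‖v‖ := by ring
        _ ≤ 1 / 2 * ‖v‖ := by gcongr)
    (by norm_num) hνinj
  have hmemW : u μ - e ∈ W := by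
    refine Submodule.span_mono ?_ hmem
    rintro _ ⟨i, hi, rfl⟩
    have hi' : b + i < m + 1 := by have := (hb i hi).1; omega
    exact ⟨⟨b + i, hi'⟩, by simp only [hνμs]⟩
  obtain ⟨hN1, hN2⟩ := huN μ hμ
  have hcea : ‖u μ - uN μ‖ ≤ (γ₀ + μmax * γ₁) * ‖e‖ / α := by
    refine norm_le_of_coercive_of_le _ hα (hcoerμ μ hμ.1) (by positivity) ?_
    have horth : (a₀ + μ • a₁) (u μ - uN μ) (u μ - e - uN μ) = 0 := by
      have h1 := hu μ hμ (u μ - e - uN μ)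
      have h2 := hN2 (u μ - e - uN μ) (sub_mem hmemW hN1)
      rw [map_sub (a₀ + μ • a₁) (u μ), LinearMap.sub_apply]
      simp only [LinearMap.add_apply, LinearMap.smul_apply, smul_eq_mul] at h1 h2 ⊢
      rw [h1, h2, sub_self]
    have hsplit : u μ - uN μ = (u μ - e - uN μ) + e := by abel
    calc (a₀ + μ • a₁) (u μ - uN μ) (u μ - uN μ)
        = (a₀ + μ • a₁) (u μ - uN μ) ((u μ - e - uN μ) + e) := by rw [← hsplit]
      _ = (a₀ + μ • a₁) (u μ - uN μ) e := by rw [map_add, horth, zero_add]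
      _ ≤ (γ₀ + μ * γ₁) * ‖u μ - uN μ‖ * ‖e‖ :=
          (le_abs_self _).trans (hboundμ μ hμ.1 _ _)
      _ ≤ (γ₀ + μmax * γ₁) * ‖u μ - uN μ‖ * ‖e‖ := by gcongr; exact hμ.2
      _ = _ := by ring
  have hpow : (1 / 2 : ℝ) ^ k ≤
      Real.exp ((h + 1) * Real.log 2) * Real.exp (-(h * Real.log 2) * (m + 1 : ℕ)) := by
    have : (1 / 2 : ℝ) ^ k = Real.exp (-(k * Real.log 2)) := by
      rw [Real.exp_neg, mul_comm, Real.exp_mul, Real.exp_log (by norm_num)]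
      simp
    rw [this, ← Real.exp_add, Real.exp_le_exp]
    push_cast
    nlinarith
  calc ‖u μ - uN μ‖ ≤ (γ₀ + μmax * γ₁) * ‖e‖ / α := hcea
    _ ≤ (γ₀ + μmax * γ₁) * ((Real.exp ((h + 1) * Real.log 2) *
          Real.exp (-(h * Real.log 2) * (m + 1 : ℕ))) * (‖f‖ / α + 1)) / α := by
        gcongr
        refine he.trans ?_
        gcongr
        exact (hu' μ hμ).trans (by linarith)
    _ = _ := by ring
end
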